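/- Let d ≥ 1, θ ≥ 0 and β > 1, and write β = [β]⁻ + {β}⁺ with [β]⁻ a nonnegative integer and {β}⁺ ∈ (0,1]. Then there are constants N₁ = N₁(d, θ, β) > 0 and N₂ = N₂(d, θ, β) > 0 such that for every [β]⁻-times continuously differentiable function φ: ℝ^d → ℝ one has N₁ |r₁^{−θ}φ|_β ≤ Σ_{|γ|≤[β]⁻} |r₁^{−θ}∂^γφ|₀ + Σ_{|γ|=[β]⁻} |r₁^{−θ}∂^γφ|_{{β}⁺} ≤ N₂ |r₁^{−θ}φ|_β, where the sums range over multi-indices γ and the inequalities are understood in [0,∞]. -/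

import Mathlib

open scoped ENNReal RealInnerProductSpace

noncomputable section

/-- `ℝ^d` with the Euclidean norm. -/
abbrev Euc (d : ℕ) : Type := EuclideanSpace ℝ (Fin d)

/-- The weight `r₁(x) = (1 + |x|²)^{1/2}`. -/
def r1 {d : ℕ} (x : Euc d) : ℝ := Real.sqrt (1 + ‖x‖ ^ 2)

/-- Sup-norm `|f|₀ = sup_x ‖f x‖`, valued in `[0,∞]`. -/
def nrm0 {d : ℕ} {V : Type*} [NormedAddCommGroup V] (f : Euc d → V) : ℝ≥0∞ :=
  ⨆ x, (‖f x‖₊ : ℝ≥0∞)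

/-- Hölder seminorm `[f]_β = sup_{x ≠ y} ‖f x - f y‖ / ‖x - y‖^β`, valued in `[0,∞]`. -/
def hsemi {d : ℕ} {V : Type*} [NormedAddCommGroup V] (β : ℝ) (f : Euc d → V) : ℝ≥0∞ :=
  ⨆ (x : Euc d) (y : Euc d) (_ : x ≠ y),
    (‖f x - f y‖₊ : ℝ≥0∞) / ENNReal.ofReal (‖x - y‖ ^ β)

/-- Partial derivative in the `i`-th coordinate direction. -/
def pder {d : ℕ} {V : Type*} [NormedAddCommGroup V] [NormedSpace ℝ V]
    (i : Fin d) (f : Euc d → V) : Euc d → V :=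
  fun x => fderiv ℝ f x (EuclideanSpace.single i 1)

/-- Iterated partial derivative in the `i`-th coordinate direction. -/
def pderPow {d : ℕ} {V : Type*} [NormedAddCommGroup V] [NormedSpace ℝ V]
    (i : Fin d) : ℕ → (Euc d → V) → Euc d → V
  | 0, f => f
  | n + 1, f => pder i (pderPow i n f)

/-- Multi-index partial derivative `∂^γ f = ∂_1^{γ 1} ⋯ ∂_d^{γ d} f`. -/
def mder {d : ℕ} {V : Type*} [NormedAddCommGroup V] [NormedSpace ℝ V]
    (γ : Fin d → ℕ) (f : Euc d → V) : Euc d → V :=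
  (List.finRange d).foldr (fun i g => pderPow i (γ i) g) f

/-- `[β]⁻`: for `β > 0`, the nonnegative integer with `β = [β]⁻ + {β}⁺`, `{β}⁺ ∈ (0,1]`. -/
def ifl (β : ℝ) : ℕ := ⌈β⌉₊ - 1

/-- `{β}⁺`: the fractional part in `(0,1]` of `β > 0`. -/
def frc (β : ℝ) : ℝ := β - (ifl β : ℝ)

/-- Hölder norm `|f|_β = Σ_{|γ| ≤ [β]⁻} |∂^γ f|₀ + Σ_{|γ| = [β]⁻} [∂^γ f]_{{β}⁺}`,
valued in `[0,∞]`. -/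
def holNorm {d : ℕ} {V : Type*} [NormedAddCommGroup V] [NormedSpace ℝ V]
    (β : ℝ) (f : Euc d → V) : ℝ≥0∞ :=
  (∑' γ : {γ : Fin d → ℕ // (∑ i, γ i) ≤ ifl β}, nrm0 (mder γ.1 f))
    + ∑' γ : {γ : Fin d → ℕ // (∑ i, γ i) = ifl β}, hsemi (frc β) (mder γ.1 f)

/-- `H̃(x) = x + H(x)`. -/
def tilde {d : ℕ} (H : Euc d → Euc d) : Euc d → Euc d := fun x => x + H x

/-- `H̃⁻¹`, the inverse map of `H̃`. -/
def tildeInv {d : ℕ} (H : Euc d → Euc d) : Euc d → Euc d := Function.invFun (tilde H)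

/-- `F(x) = H̃⁻¹(x) - x`, so that `H̃⁻¹(x) = x + F(x)`. -/
def Fof {d : ℕ} (H : Euc d → Euc d) : Euc d → Euc d := fun x => tildeInv H x - x

/-! ### Partial derivatives -/

section PartialDerivatives

variable {d : ℕ}

lemma pder_add {f g : Euc d → ℝ} (hf : Differentiable ℝ f) (hg : Differentiable ℝ g)
    (i : Fin d) : pder i (fun x => f x + g x) = fun x => pder i f x + pder i g x := by
  funext x
  simp only [pder]
  rw [fderiv_fun_add (hf x) (hg x)]
  rfl

lemma pder_mul {f g : Euc d → ℝ} (hf : Differentiable ℝ f) (hg : Differentiable ℝ g)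
    (i : Fin d) :
    pder i (fun x => f x * g x) = fun x => pder i f x * g x + f x * pder i g x := by
  funext x
  simp only [pder]
  rw [fderiv_fun_mul (hf x) (hg x)]
  simp only [add_apply, smul_apply, smul_eq_mul]
  ring

lemma contDiff_pder {n : ℕ} {f : Euc d → ℝ} (hf : ContDiff ℝ (n + 1 : ℕ) f) (i : Fin d) :
    ContDiff ℝ n (pder i f) :=
  (hf.fderiv_right (m := n) (by push_cast; rfl)).clm_apply contDiff_const

lemma contDiff_pderPow {n k : ℕ} {f : Euc d → ℝ} (hf : ContDiff ℝ (n + k : ℕ) f) (i : Fin d) :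
    ContDiff ℝ n (pderPow i k f) := by
  induction k generalizing n with
  | zero => exact hf
  | succ k ih =>
    exact contDiff_pder (ih (by rwa [show n + 1 + k = n + (k + 1) by ring])) i

lemma pder_comm {f : Euc d → ℝ} (hf : ContDiff ℝ 2 f) (i j : Fin d) :
    pder i (pder j f) = pder j (pder i f) := by
  funext x
  have hd : DifferentiableAt ℝ (fderiv ℝ f) x :=
    ((hf.fderiv_right (m := 1) (by norm_num)).differentiable one_ne_zero) x
  have hsymm : IsSymmSndFDerivAt ℝ f x := hf.contDiffAt.isSymmSndFDerivAt (by simp)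
  have key : ∀ v w : Euc d,
      fderiv ℝ (fun y => fderiv ℝ f y v) x w = fderiv ℝ (fderiv ℝ f) x w v := by
    intro v w
    rw [fderiv_clm_apply hd (differentiableAt_const v)]
    simp
  unfold pder
  rw [key, key]
  exact hsymm _ _

lemma pder_pderPow_comm {k : ℕ} {f : Euc d → ℝ} (hf : ContDiff ℝ (k + 1 : ℕ) f) (i j : Fin d) :
    pder i (pderPow j k f) = pderPow j k (pder i f) := by
  induction k with
  | zero => rfl
  | succ k ih =>
    have h2 : ContDiff ℝ (2 : ℕ) (pderPow j k f) :=
      contDiff_pderPow (hf.of_le (by exact_mod_cast (by omega))) j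
    simp only [pderPow]
    rw [pder_comm h2, ih (hf.of_le (by exact_mod_cast (by omega)))]

lemma contDiff_foldr_pderPow {n : ℕ} (γ : Fin d → ℕ) (l : List (Fin d)) {f : Euc d → ℝ}
    (hf : ContDiff ℝ (n + (l.map γ).sum : ℕ) f) :
    ContDiff ℝ n (l.foldr (fun i g => pderPow i (γ i) g) f) := by
  induction l generalizing n with
  | nil => simpa using hf
  | cons a l ih =>
    simp only [List.foldr_cons]
    refine contDiff_pderPow (ih ?_) a
    simpa [add_assoc] using hf

lemma foldr_pderPow_congr {γ γ' : Fin d → ℕ} (l : List (Fin d)) (h : ∀ i ∈ l, γ i = γ' i)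
    (f : Euc d → ℝ) :
    l.foldr (fun i g => pderPow i (γ i) g) f = l.foldr (fun i g => pderPow i (γ' i) g) f := by
  induction l with
  | nil => rfl
  | cons a l ih =>
    simp only [List.foldr_cons]
    rw [ih fun i hi => h i (List.mem_cons_of_mem _ hi), h a List.mem_cons_self]

lemma pder_foldr_pderPow (γ : Fin d → ℕ) (i : Fin d) (l : List (Fin d)) (hl : l.Nodup)
    (hi : i ∈ l) {f : Euc d → ℝ} (hf : ContDiff ℝ ((l.map γ).sum + 1 : ℕ) f) :
    pder i (l.foldr (fun j g => pderPow j (γ j) g) f) =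
      l.foldr (fun j g => pderPow j ((γ + Pi.single i 1 : Fin d → ℕ) j) g) f := by
  induction l with
  | nil => simp at hi
  | cons a l ih =>
    simp only [List.foldr_cons]
    rw [List.nodup_cons] at hl
    have hsum : ContDiff ℝ (γ a + 1 + (l.map γ).sum : ℕ) f := by
      refine hf.of_le (le_of_eq ?_)
      simp only [List.map_cons, List.sum_cons]
      exact_mod_cast (by omega)
    by_cases hia : i = a
    · subst hia
      rw [foldr_pderPow_congr (γ := γ + Pi.single i 1) (γ' := γ) l]
      · simp [pderPow]
      · intro j hj
        have : j ≠ i := fun h => hl.1 (h ▸ hj)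
        simp [this]
    · have hil : i ∈ l := by simpa [hia] using hi
      rw [pder_pderPow_comm (contDiff_foldr_pderPow γ l hsum),
        ih hl.2 hil (hf.of_le (by
          simp only [List.map_cons, List.sum_cons]
          exact_mod_cast (by omega)))]
      have : (γ + Pi.single i 1 : Fin d → ℕ) a = γ a := by simp [Ne.symm hia]
      rw [this]

lemma sum_map_finRange (γ : Fin d → ℕ) : ((List.finRange d).map γ).sum = ∑ i, γ i := by
  rw [← List.ofFn_eq_map, List.sum_ofFn]

lemma contDiff_mder {n : ℕ} {γ : Fin d → ℕ} {f : Euc d → ℝ}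
    (hf : ContDiff ℝ (n + ∑ i, γ i : ℕ) f) : ContDiff ℝ n (mder γ f) :=
  contDiff_foldr_pderPow γ _ (by rwa [sum_map_finRange])

lemma pder_mder {γ : Fin d → ℕ} {f : Euc d → ℝ} (hf : ContDiff ℝ ((∑ i, γ i) + 1 : ℕ) f)
    (i : Fin d) : pder i (mder γ f) = mder (γ + Pi.single i 1) f :=
  pder_foldr_pderPow γ i _ (List.nodup_finRange d) (List.mem_finRange i)
    (by rwa [sum_map_finRange])

lemma mder_zero (f : Euc d → ℝ) : mder 0 f = f := by
  have : ∀ l : List (Fin d), l.foldr (fun i g => pderPow i ((0 : Fin d → ℕ) i) g) f = f := by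
    intro l
    induction l with
    | nil => rfl
    | cons a l ih => simp only [List.foldr_cons, ih]; rfl
  exact this _

lemma sum_add_single (γ : Fin d → ℕ) (i : Fin d) :
    ∑ j, (γ + Pi.single i 1 : Fin d → ℕ) j = (∑ j, γ j) + 1 := by
  simp [Finset.sum_add_distrib]

end PartialDerivatives

/-! ### The weight and its symbol algebra -/

section Symbols

variable {d : ℕ}

lemma r1_pos (x : Euc d) : 0 < r1 x := Real.sqrt_pos.2 (by positivity)

lemma one_le_r1 (x : Euc d) : 1 ≤ r1 x :=
  Real.one_le_sqrt.2 (by nlinarith [sq_nonneg ‖x‖])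

lemma norm_le_r1 (x : Euc d) : ‖x‖ ≤ r1 x :=
  Real.le_sqrt_of_sq_le (by linarith)

lemma contDiff_r1 {n : ℕ} : ContDiff ℝ n (r1 : Euc d → ℝ) := by
  unfold r1
  exact (contDiff_const.add (contDiff_norm_sq ℝ)).sqrt fun x => by positivity

lemma contDiff_r1_rpow {n : ℕ} (s : ℝ) : ContDiff ℝ n (fun x : Euc d => r1 x ^ s) :=
  contDiff_r1.rpow_const_of_ne fun x => (r1_pos x).ne'

lemma pder_r1_rpow (s : ℝ) (i : Fin d) :
    pder i (fun x => r1 x ^ s) =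
      fun x => r1 x ^ s * (s * ((x i * (r1 x)⁻¹) * (r1 x)⁻¹)) := by
  funext x
  have hsq : HasFDerivAt (fun x : Euc d => 1 + ‖x‖ ^ 2) (2 • innerSL ℝ x) x :=
    (hasStrictFDerivAt_norm_sq x).hasFDerivAt.const_add 1
  have h := (hsq.sqrt (by positivity)).rpow_const (p := s) (Or.inl (r1_pos x).ne')
  change fderiv ℝ (fun x => Real.sqrt (1 + ‖x‖ ^ 2) ^ s) x _ = _
  rw [h.fderiv]
  have hx := r1_pos x
  have hr : Real.sqrt (1 + ‖x‖ ^ 2) = r1 x := rfl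
  rw [hr, Real.rpow_sub_one hx.ne']
  simp [EuclideanSpace.inner_single_right]
  field_simp

/-- The algebra generated by the constants, `x_i / r₁` and `1 / r₁`: bounded smooth functions,
stable under partial derivatives. -/
inductive IsSymbol : (Euc d → ℝ) → Prop
  | const (c : ℝ) : IsSymbol fun _ => c
  | dir (i : Fin d) : IsSymbol fun x => x i * (r1 x)⁻¹
  | inv : IsSymbol fun x => (r1 x)⁻¹
  | add {f g : Euc d → ℝ} : IsSymbol f → IsSymbol g → IsSymbol fun x => f x + g x
  | mul {f g : Euc d → ℝ} : IsSymbol f → IsSymbol g → IsSymbol fun x => f x * g x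

lemma contDiff_coord {n : ℕ} (i : Fin d) : ContDiff ℝ n (fun x : Euc d => x i) :=
  (EuclideanSpace.proj (𝕜 := ℝ) i).contDiff

lemma contDiff_inv_r1 {n : ℕ} : ContDiff ℝ n (fun x : Euc d => (r1 x)⁻¹) :=
  contDiff_r1.inv fun x => (r1_pos x).ne'

lemma IsSymbol.contDiff {b : Euc d → ℝ} (hb : IsSymbol b) {n : ℕ} : ContDiff ℝ n b := by
  induction hb with
  | const c => exact contDiff_const
  | dir i => exact (contDiff_coord i).mul contDiff_inv_r1
  | inv => exact contDiff_inv_r1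
  | add _ _ hf hg => exact hf.add hg
  | mul _ _ hf hg => exact hf.mul hg

lemma IsSymbol.differentiable {b : Euc d → ℝ} (hb : IsSymbol b) : Differentiable ℝ b :=
  (hb.contDiff (n := 1)).differentiable (by simp)

lemma IsSymbol.bounded {b : Euc d → ℝ} (hb : IsSymbol b) : ∃ K, 0 ≤ K ∧ ∀ x, |b x| ≤ K := by
  induction hb with
  | const c => exact ⟨|c|, abs_nonneg c, fun _ => le_rfl⟩
  | dir i =>
    refine ⟨1, zero_le_one, fun x => ?_⟩
    rw [abs_mul, abs_inv, abs_of_pos (r1_pos x), ← div_eq_mul_inv, div_le_one (r1_pos x)]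
    exact (PiLp.norm_apply_le x i).trans (norm_le_r1 x)
  | inv =>
    refine ⟨1, zero_le_one, fun x => ?_⟩
    rw [abs_inv, abs_of_pos (r1_pos x)]
    exact inv_le_one_of_one_le₀ (one_le_r1 x)
  | add _ _ hf hg =>
    obtain ⟨K, hK, hf⟩ := hf
    obtain ⟨L, hL, hg⟩ := hg
    exact ⟨K + L, add_nonneg hK hL, fun x => (abs_add_le _ _).trans (add_le_add (hf x) (hg x))⟩
  | mul _ _ hf hg =>
    obtain ⟨K, hK, hf⟩ := hf
    obtain ⟨L, hL, hg⟩ := hg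
    refine ⟨K * L, mul_nonneg hK hL, fun x => ?_⟩
    rw [abs_mul]
    exact mul_le_mul (hf x) (hg x) (abs_nonneg _) hK

lemma pder_inv_r1 (i : Fin d) :
    pder i (fun x => (r1 x)⁻¹) =
      fun x => (r1 x)⁻¹ * (-1 * ((x i * (r1 x)⁻¹) * (r1 x)⁻¹)) := by
  simpa only [Real.rpow_neg_one] using pder_r1_rpow (d := d) (-1) i

lemma pder_coord (i j : Fin d) :
    pder j (fun x : Euc d => x i) = fun _ => if i = j then 1 else 0 := by
  funext x
  have h : HasFDerivAt (fun x : Euc d => x i) (EuclideanSpace.proj (𝕜 := ℝ) i) x :=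
    (EuclideanSpace.proj (𝕜 := ℝ) i).hasFDerivAt
  simp [pder, h.fderiv]

lemma IsSymbol.pder {b : Euc d → ℝ} (hb : IsSymbol b) (j : Fin d) : IsSymbol (pder j b) := by
  induction hb with
  | const c =>
    convert IsSymbol.const (d := d) 0 using 1
    funext x
    simp [_root_.pder]
  | dir i =>
    rw [pder_mul ((contDiff_coord (n := 1) i).differentiable (by simp))
      ((contDiff_inv_r1 (n := 1)).differentiable (by simp)), pder_inv_r1, pder_coord]
    convert ((IsSymbol.const (if i = j then 1 else 0)).mul IsSymbol.inv).add
      ((IsSymbol.dir i).mul ((IsSymbol.const (-1)).mul ((IsSymbol.dir j).mul .inv))) using 3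
    ring
  | inv =>
    rw [pder_inv_r1]
    exact IsSymbol.inv.mul ((IsSymbol.const (-1)).mul ((IsSymbol.dir j).mul .inv))
  | add hf hg hf' hg' =>
    rw [pder_add hf.differentiable hg.differentiable]
    exact hf'.add hg'
  | mul hf hg hf' hg' =>
    rw [pder_mul hf.differentiable hg.differentiable]
    exact (hf'.mul hg).add (hf.mul hg')

/-- Differential operators of order at most `k` with coefficients in the symbol algebra. -/
inductive IsSymbolOp (k : ℕ) : ((Euc d → ℝ) → Euc d → ℝ) → Prop
  | term {b : Euc d → ℝ} {δ : Fin d → ℕ} (hb : IsSymbol b) (hδ : ∑ i, δ i ≤ k) :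
      IsSymbolOp k fun f x => b x * mder δ f x
  | add {S T : (Euc d → ℝ) → Euc d → ℝ} :
      IsSymbolOp k S → IsSymbolOp k T → IsSymbolOp k fun f x => S f x + T f x

lemma IsSymbolOp.mono {k l : ℕ} (hkl : k ≤ l) {T : (Euc d → ℝ) → Euc d → ℝ}
    (hT : IsSymbolOp k T) : IsSymbolOp l T := by
  induction hT with
  | term hb hδ => exact .term hb (hδ.trans hkl)
  | add _ _ hS hT => exact hS.add hT

lemma IsSymbolOp.symbol_mul {k : ℕ} {T : (Euc d → ℝ) → Euc d → ℝ} (hT : IsSymbolOp k T)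
    {a : Euc d → ℝ} (ha : IsSymbol a) : IsSymbolOp k fun f x => a x * T f x := by
  induction hT with
  | term hb hδ =>
    simp only [← mul_assoc]
    exact .term (ha.mul hb) hδ
  | add _ _ hS hT =>
    simp only [mul_add]
    exact hS.add hT

lemma IsSymbolOp.contDiff {n k : ℕ} {T : (Euc d → ℝ) → Euc d → ℝ} (hT : IsSymbolOp k T)
    {f : Euc d → ℝ} (hf : ContDiff ℝ (n + k : ℕ) f) : ContDiff ℝ n (T f) := by
  induction hT with
  | term hb hδ =>
    exact hb.contDiff.mul (contDiff_mder (hf.of_le (by exact_mod_cast (by omega))))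
  | add _ _ hS hT => exact hS.add hT

lemma IsSymbolOp.exists_pder {k : ℕ} {T : (Euc d → ℝ) → Euc d → ℝ} (hT : IsSymbolOp k T)
    (i : Fin d) : ∃ T' : (Euc d → ℝ) → Euc d → ℝ, IsSymbolOp (k + 1) T' ∧
      ∀ f : Euc d → ℝ, ContDiff ℝ (k + 1 : ℕ) f → pder i (T f) = T' f := by
  induction hT with
  | @term b δ hb hδ =>
    refine ⟨_, (IsSymbolOp.term (hb.pder i) (hδ.trans k.le_succ)).add
      (.term (δ := δ + Pi.single i 1) hb ?_), fun f hf => ?_⟩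
    · rw [sum_add_single]
      omega
    · rw [pder_mul hb.differentiable, pder_mder (hf.of_le (by exact_mod_cast (by omega)))]
      exact (contDiff_mder (n := 1) (hf.of_le (by exact_mod_cast (by omega)))).differentiable
        (by simp)
  | add hS hT ihS ihT =>
    obtain ⟨S', hS', hSeq⟩ := ihS
    obtain ⟨T', hT', hTeq⟩ := ihT
    refine ⟨_, hS'.add hT', fun f hf => ?_⟩
    have hf' : ContDiff ℝ (1 + k : ℕ) f := by rwa [add_comm]
    rw [pder_add ((hS.contDiff hf').differentiable (by simp))
      ((hT.contDiff hf').differentiable (by simp)), hSeq f hf, hTeq f hf]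

/-- Conjugating `∂^γ` by a power of the weight yields an operator with symbol coefficients. -/
lemma exists_symbolOp_mder (s : ℝ) (γ : Fin d → ℕ) :
    ∃ T : (Euc d → ℝ) → Euc d → ℝ, IsSymbolOp (∑ i, γ i) T ∧
      ∀ f : Euc d → ℝ, ContDiff ℝ (∑ i, γ i : ℕ) f →
        mder γ (fun x => r1 x ^ s * f x) = fun x => r1 x ^ s * T f x := by
  induction hk : ∑ i, γ i generalizing γ with
  | zero =>
    have h0 : γ = 0 := by
      funext i
      simpa using (Finset.sum_eq_zero_iff.1 hk) i (Finset.mem_univ i)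
    refine ⟨_, IsSymbolOp.term (δ := 0) (IsSymbol.const 1) (by simp), fun f _ => ?_⟩
    simp only [h0, mder_zero, one_mul]
  | succ k ih =>
    obtain ⟨i, hi⟩ : ∃ i, γ i ≠ 0 := by
      by_contra! h
      simp [h] at hk
    obtain ⟨γ', rfl⟩ : ∃ γ' : Fin d → ℕ, γ = γ' + Pi.single i 1 := by
      refine ⟨γ - Pi.single i 1, ?_⟩
      funext j
      by_cases hj : j = i
      · subst hj
        simp
        omega
      · simp [hj]
    rw [sum_add_single] at hk
    have hk' : ∑ j, γ' j = k := by omega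
    obtain ⟨T, hT, hTeq⟩ := ih γ' hk'
    obtain ⟨T', hT', hTeq'⟩ := hT.exists_pder i
    have ha : IsSymbol fun x : Euc d => s * ((x i * (r1 x)⁻¹) * (r1 x)⁻¹) :=
      (IsSymbol.const s).mul ((IsSymbol.dir i).mul .inv)
    refine ⟨_, ((hT.symbol_mul ha).mono k.le_succ).add hT', fun f hf => ?_⟩
    have hf' : ContDiff ℝ (1 + k : ℕ) f := by rwa [add_comm]
    rw [← pder_mder (by rw [hk']; exact (contDiff_r1_rpow s).mul hf),
      hTeq f (hf.of_le (by exact_mod_cast (by omega))),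
      pder_mul ((contDiff_r1_rpow (n := 1) s).differentiable (by simp))
        ((hT.contDiff hf').differentiable (by simp)), pder_r1_rpow, hTeq' f hf]
    funext x
    ring

end Symbols

/-! ### Hölder bounds -/

section HolderBounds

variable {d : ℕ}

/-- `g` is bounded by `M` and `α`-Hölder with constant `M`. -/
def HolderBound (α M : ℝ) (g : Euc d → ℝ) : Prop :=
  (∀ x, |g x| ≤ M) ∧ ∀ x y, |g x - g y| ≤ M * ‖x - y‖ ^ α

lemma HolderBound.mul {α K M : ℝ} {b g : Euc d → ℝ}
    (hb : HolderBound α K b) (hg : HolderBound α M g) :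
    HolderBound α (2 * K * M) fun x => b x * g x := by
  have hK : 0 ≤ K := (abs_nonneg _).trans (hb.1 0)
  have hM : 0 ≤ M := (abs_nonneg _).trans (hg.1 0)
  refine ⟨fun x => ?_, fun x y => ?_⟩
  · rw [abs_mul]
    nlinarith [mul_le_mul (hb.1 x) (hg.1 x) (abs_nonneg _) hK, mul_nonneg hK hM]
  · have hxy : 0 ≤ ‖x - y‖ ^ α := by positivity
    calc |b x * g x - b y * g y| = |(b x - b y) * g x + b y * (g x - g y)| := by ring_nf
      _ ≤ |b x - b y| * |g x| + |b y| * |g x - g y| := by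
        rw [← abs_mul, ← abs_mul]
        exact abs_add_le _ _
      _ ≤ (K * ‖x - y‖ ^ α) * M + K * (M * ‖x - y‖ ^ α) :=
        add_le_add
          (mul_le_mul (hb.2 x y) (hg.1 x) (abs_nonneg _) (mul_nonneg hK hxy))
          (mul_le_mul (hb.1 y) (hg.2 x y) (abs_nonneg _) hK)
      _ = 2 * K * M * ‖x - y‖ ^ α := by ring

lemma HolderBound.add {α K M : ℝ} {b g : Euc d → ℝ}
    (hb : HolderBound α K b) (hg : HolderBound α M g) :
    HolderBound α (K + M) fun x => b x + g x := by
  refine ⟨fun x => (abs_add_le _ _).trans (add_le_add (hb.1 x) (hg.1 x)), fun x y => ?_⟩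
  calc |b x + g x - (b y + g y)| = |(b x - b y) + (g x - g y)| := by ring_nf
    _ ≤ |b x - b y| + |g x - g y| := abs_add_le _ _
    _ ≤ (K + M) * ‖x - y‖ ^ α := by linarith [hb.2 x y, hg.2 x y]

lemma norm_fderiv_le_of_pder_le {g : Euc d → ℝ} {M : ℝ} (hM : 0 ≤ M) {x : Euc d}
    (h : ∀ i, |pder i g x| ≤ M) : ‖fderiv ℝ g x‖ ≤ d * M := by
  refine ContinuousLinearMap.opNorm_le_bound _ (by positivity) fun v => ?_
  have hv : v = ∑ i, v i • EuclideanSpace.single i (1 : ℝ) := by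
    simpa using ((EuclideanSpace.basisFun (Fin d) ℝ).sum_repr v).symm
  calc ‖fderiv ℝ g x v‖ = ‖∑ i, v i * pder i g x‖ := by
        conv_lhs => rw [hv]
        simp [pder]
    _ ≤ ∑ i, ‖v i * pder i g x‖ := norm_sum_le _ _
    _ ≤ ∑ _i : Fin d, M * ‖v‖ := Finset.sum_le_sum fun i _ => by
        rw [norm_mul, mul_comm]
        exact mul_le_mul (h i) (PiLp.norm_apply_le v i) (norm_nonneg _) hM
    _ = d * M * ‖v‖ := by simp [mul_assoc]

lemma holderBound_of_pder_le {α : ℝ} (hα₀ : 0 ≤ α) (hα₁ : α ≤ 1) {g : Euc d → ℝ}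
    (hg : Differentiable ℝ g) {M : ℝ} (h₀ : ∀ x, |g x| ≤ M) (h₁ : ∀ i x, |pder i g x| ≤ M) :
    HolderBound α ((d + 2) * M) g := by
  have hM : 0 ≤ M := (abs_nonneg _).trans (h₀ 0)
  have hd : (0 : ℝ) ≤ d := Nat.cast_nonneg d
  refine ⟨fun x => (h₀ x).trans (by nlinarith), fun x y => ?_⟩
  rcases le_total ‖x - y‖ 1 with hxy | hxy
  · have hlip : ‖g x - g y‖ ≤ d * M * ‖x - y‖ :=
      convex_univ.norm_image_sub_le_of_norm_fderiv_le (fun z _ => hg z)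
        (fun z _ => norm_fderiv_le_of_pder_le hM fun i => h₁ i z) (Set.mem_univ y)
        (Set.mem_univ x)
    have hpow : ‖x - y‖ ≤ ‖x - y‖ ^ α := by
      rcases (norm_nonneg (x - y)).eq_or_lt with h0 | h0
      · rw [← h0]
        exact Real.rpow_nonneg le_rfl α
      · simpa using Real.rpow_le_rpow_of_exponent_ge h0 hxy hα₁
    calc |g x - g y| ≤ d * M * ‖x - y‖ := hlip
      _ ≤ d * M * ‖x - y‖ ^ α := by gcongr
      _ ≤ (d + 2) * M * ‖x - y‖ ^ α := by gcongr; linarith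
  · have hpow : 1 ≤ ‖x - y‖ ^ α := Real.one_le_rpow hxy hα₀
    calc |g x - g y| ≤ |g x| + |g y| := abs_sub _ _
      _ ≤ (d + 2) * M * 1 := by nlinarith [h₀ x, h₀ y]
      _ ≤ (d + 2) * M * ‖x - y‖ ^ α := by gcongr

lemma IsSymbol.holderBound {α : ℝ} (hα₀ : 0 ≤ α) (hα₁ : α ≤ 1) {b : Euc d → ℝ}
    (hb : IsSymbol b) : ∃ K, 0 ≤ K ∧ HolderBound α K b := by
  obtain ⟨K, hK, h₀⟩ := hb.bounded
  choose L hL h₁ using fun i => (hb.pder i).bounded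
  have hsum : 0 ≤ ∑ i, L i := Finset.sum_nonneg fun i _ => hL i
  refine ⟨(d + 2) * (K + ∑ i, L i), by positivity,
    holderBound_of_pder_le hα₀ hα₁ hb.differentiable (fun x => ?_) fun i x => ?_⟩
  · linarith [h₀ x]
  · linarith [h₁ i x, Finset.single_le_sum (fun i _ => hL i) (Finset.mem_univ i)]

/-- Weighted bounds for `f`: all `r₁^t ∂^γ f` with `|γ| ≤ m` are bounded by `M`, and those with
`|γ| = m` are moreover `α`-Hölder with constant `M`. -/
def WeightedBound (m : ℕ) (α t M : ℝ) (f : Euc d → ℝ) : Prop :=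
  (∀ γ : Fin d → ℕ, ∑ i, γ i ≤ m → ∀ x, |r1 x ^ t * mder γ f x| ≤ M) ∧
    ∀ γ : Fin d → ℕ, ∑ i, γ i = m → HolderBound α M fun x => r1 x ^ t * mder γ f x

lemma exists_holderBound_mder (m : ℕ) {α : ℝ} (hα₀ : 0 ≤ α) (hα₁ : α ≤ 1) (t : ℝ)
    {δ : Fin d → ℕ} (hδ : ∑ i, δ i ≤ m) :
    ∃ C, 0 ≤ C ∧ ∀ (f : Euc d → ℝ) (M : ℝ), ContDiff ℝ m f → WeightedBound m α t M f →
      HolderBound α (C * M) fun x => r1 x ^ t * mder δ f x := by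
  rcases hδ.eq_or_lt with hm | hm
  · exact ⟨1, zero_le_one, fun f M _ h => by simpa using h.2 δ hm⟩
  choose K hK hKb using fun i : Fin d =>
    ((IsSymbol.const t).mul ((IsSymbol.dir i).mul .inv)).bounded
  have hsum : 0 ≤ ∑ i, K i := Finset.sum_nonneg fun i _ => hK i
  refine ⟨(d + 2) * (1 + ∑ i, K i), by positivity, fun f M hf h => ?_⟩
  have hM : 0 ≤ M := (abs_nonneg _).trans (h.1 δ hδ 0)
  have hdiff : Differentiable ℝ (mder δ f) :=
    (contDiff_mder (n := 1) (hf.of_le (by exact_mod_cast (by omega)))).differentiable (by simp)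
  have hw : Differentiable ℝ fun x : Euc d => r1 x ^ t :=
    (contDiff_r1_rpow (n := 1) t).differentiable (by simp)
  rw [mul_assoc]
  refine holderBound_of_pder_le hα₀ hα₁ (hw.fun_mul hdiff) (fun x => ?_) fun i x => ?_
  · nlinarith [h.1 δ hδ x, mul_nonneg hsum hM]
  · rw [pder_mul hw hdiff, pder_r1_rpow, pder_mder (hf.of_le (by exact_mod_cast (by omega)))]
    have hnext := h.1 (δ + Pi.single i 1) (by rw [sum_add_single]; omega) x
    have hKi : K i ≤ ∑ i, K i :=
      Finset.single_le_sum (fun i _ => hK i) (Finset.mem_univ i)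
    have hprod := mul_le_mul ((hKb i x).trans hKi) (h.1 δ hδ x) (abs_nonneg _) hsum
    rw [← abs_mul] at hprod
    refine (abs_add_le _ _).trans ?_
    rw [add_mul, one_mul, add_comm]
    refine add_le_add hnext ?_
    refine le_of_eq_of_le (congrArg abs ?_) hprod
    ring

lemma IsSymbolOp.exists_holderBound {m : ℕ} {α : ℝ} (hα₀ : 0 ≤ α) (hα₁ : α ≤ 1) (t : ℝ)
    {T : (Euc d → ℝ) → Euc d → ℝ} (hT : IsSymbolOp m T) :
    ∃ C, 0 ≤ C ∧ ∀ (f : Euc d → ℝ) (M : ℝ), ContDiff ℝ m f → WeightedBound m α t M f →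
      HolderBound α (C * M) fun x => r1 x ^ t * T f x := by
  induction hT with
  | @term b δ hb hδ =>
    obtain ⟨K, hK, hbK⟩ := hb.holderBound hα₀ hα₁
    obtain ⟨C, hC, h⟩ := exists_holderBound_mder m hα₀ hα₁ t hδ
    refine ⟨2 * K * C, by positivity, fun f M hf hM => ?_⟩
    convert hbK.mul (h f M hf hM) using 1
    · ring
    · funext x
      ring
  | add _ _ hS hT =>
    obtain ⟨C, hC, hS⟩ := hS
    obtain ⟨C', hC', hT⟩ := hT
    refine ⟨C + C', add_nonneg hC hC', fun f M hf hM => ?_⟩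
    convert (hS f M hf hM).add (hT f M hf hM) using 1
    · ring
    · funext x
      ring

lemma exists_holderBound_mder_weight (m : ℕ) {α : ℝ} (hα₀ : 0 ≤ α) (hα₁ : α ≤ 1) (s t : ℝ)
    {γ : Fin d → ℕ} (hγ : ∑ i, γ i ≤ m) :
    ∃ C, 0 ≤ C ∧ ∀ (f : Euc d → ℝ) (M : ℝ), ContDiff ℝ m f → WeightedBound m α (t + s) M f →
      HolderBound α (C * M) fun x => r1 x ^ t * mder γ (fun y => r1 y ^ s * f y) x := by
  obtain ⟨T, hT, hTeq⟩ := exists_symbolOp_mder s γ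
  obtain ⟨C, hC, h⟩ := (hT.mono hγ).exists_holderBound hα₀ hα₁ (t + s)
  refine ⟨C, hC, fun f M hf hM => ?_⟩
  rw [hTeq f (hf.of_le (by exact_mod_cast hγ))]
  convert h f M hf hM using 2 with x
  rw [Real.rpow_add (r1_pos x), mul_assoc]

end HolderBounds

/-! ### Weighted Hölder norms -/

section WeightedNorms

variable {d : ℕ}

/-- The weighted norm `Σ_{|γ| ≤ m} |r₁^t ∂^γ f|₀ + Σ_{|γ| = m} [r₁^t ∂^γ f]_α`. -/
def weightedNorm (m : ℕ) (α t : ℝ) (f : Euc d → ℝ) : ℝ≥0∞ :=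
  (∑' γ : {γ : Fin d → ℕ // (∑ i, γ i) ≤ m}, nrm0 (fun x => r1 x ^ t * mder γ.1 f x))
    + ∑' γ : {γ : Fin d → ℕ // (∑ i, γ i) = m}, hsemi α (fun x => r1 x ^ t * mder γ.1 f x)

lemma HolderBound.nrm0_le {α M : ℝ} {g : Euc d → ℝ} (h : HolderBound α M g) :
    nrm0 g ≤ ENNReal.ofReal M := by
  refine iSup_le fun x => ?_
  rw [← enorm_eq_nnnorm, ← ofReal_norm]
  exact ENNReal.ofReal_le_ofReal (h.1 x)

lemma HolderBound.hsemi_le {α M : ℝ} {g : Euc d → ℝ} (h : HolderBound α M g) :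
    hsemi α g ≤ ENNReal.ofReal M := by
  refine iSup_le fun x => iSup_le fun y => iSup_le fun _ => ?_
  refine ENNReal.div_le_of_le_mul ?_
  have hM : 0 ≤ M := (abs_nonneg _).trans (h.1 0)
  rw [← enorm_eq_nnnorm, ← ofReal_norm, ← ENNReal.ofReal_mul hM]
  exact ENNReal.ofReal_le_ofReal (h.2 x y)

lemma abs_le_of_nrm0_le {g : Euc d → ℝ} {A : ℝ≥0∞} (hA : A ≠ ⊤) (h : nrm0 g ≤ A) (x : Euc d) :
    |g x| ≤ A.toReal := by
  have hx : (‖g x‖₊ : ℝ≥0∞) ≤ A := (le_iSup (fun x => (‖g x‖₊ : ℝ≥0∞)) x).trans h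
  simpa using ENNReal.toReal_mono hA hx

lemma abs_sub_le_of_hsemi_le {α : ℝ} {g : Euc d → ℝ} {A : ℝ≥0∞} (hA : A ≠ ⊤)
    (h : hsemi α g ≤ A) (x y : Euc d) : |g x - g y| ≤ A.toReal * ‖x - y‖ ^ α := by
  have hpow : 0 ≤ ‖x - y‖ ^ α := by positivity
  rcases eq_or_ne x y with rfl | hxy
  · simpa using mul_nonneg ENNReal.toReal_nonneg hpow
  have hpos : 0 < ‖x - y‖ ^ α := Real.rpow_pos_of_pos (norm_pos_iff.2 (sub_ne_zero.2 hxy)) α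
  have hx : (‖g x - g y‖₊ : ℝ≥0∞) / ENNReal.ofReal (‖x - y‖ ^ α) ≤ A :=
    (le_iSup₂_of_le x y (le_iSup_of_le (f := fun _ : x ≠ y =>
      (‖g x - g y‖₊ : ℝ≥0∞) / ENNReal.ofReal (‖x - y‖ ^ α)) hxy le_rfl)).trans h
  have := ENNReal.toReal_mono hA hx
  rw [ENNReal.toReal_div, ENNReal.toReal_ofReal hpow, div_le_iff₀ hpos] at this
  simpa using this

lemma weightedBound_of_weightedNorm_ne_top {m : ℕ} {α t : ℝ} {f : Euc d → ℝ}
    (h : weightedNorm m α t f ≠ ⊤) :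
    WeightedBound m α t (weightedNorm m α t f).toReal f := by
  have h₀ : ∀ γ : Fin d → ℕ, ∑ i, γ i ≤ m →
      ∀ x, |r1 x ^ t * mder γ f x| ≤ (weightedNorm m α t f).toReal := fun γ hγ =>
    abs_le_of_nrm0_le h ((ENNReal.le_tsum
      (f := fun γ : {γ : Fin d → ℕ // (∑ i, γ i) ≤ m} =>
        nrm0 (fun x => r1 x ^ t * mder γ.1 f x)) ⟨γ, hγ⟩).trans le_self_add)
  refine ⟨h₀, fun γ hγ => ⟨h₀ γ hγ.le, ?_⟩⟩
  exact abs_sub_le_of_hsemi_le h ((ENNReal.le_tsum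
      (f := fun γ : {γ : Fin d → ℕ // (∑ i, γ i) = m} =>
        hsemi α (fun x => r1 x ^ t * mder γ.1 f x)) ⟨γ, hγ⟩).trans le_add_self)

lemma finite_sum_le (m : ℕ) : Finite {γ : Fin d → ℕ // (∑ i, γ i) ≤ m} :=
  ((Set.finite_Iic (fun _ : Fin d => m)).subset fun _ hγ i =>
    (Finset.single_le_sum (fun _ _ => Nat.zero_le _) (Finset.mem_univ i)).trans hγ).to_subtype

lemma finite_sum_eq (m : ℕ) : Finite {γ : Fin d → ℕ // (∑ i, γ i) = m} :=
  have := finite_sum_le (d := d) m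
  Finite.of_injective _ (Subtype.impEmbedding (fun γ : Fin d → ℕ => (∑ i, γ i) = m)
    (fun γ => (∑ i, γ i) ≤ m) fun _ h => h.le).injective

lemma tsum_le_ofReal_tsum_mul {ι : Type*} [Finite ι] {F : ι → ℝ≥0∞} {C : ι → ℝ}
    (hC : ∀ i, 0 ≤ C i) {A : ℝ≥0∞} (h : ∀ i, F i ≤ ENNReal.ofReal (C i) * A) :
    ∑' i, F i ≤ ENNReal.ofReal (∑' i, C i) * A := by
  rw [ENNReal.ofReal_tsum_of_nonneg hC Summable.of_finite, ← ENNReal.tsum_mul_right]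
  exact ENNReal.tsum_le_tsum h

lemma exists_weightedNorm_le (d m : ℕ) {α : ℝ} (hα₀ : 0 ≤ α) (hα₁ : α ≤ 1) (s t : ℝ) :
    ∃ N : ℝ, 0 < N ∧ ∀ f : Euc d → ℝ, ContDiff ℝ m f →
      weightedNorm m α t (fun x => r1 x ^ s * f x) ≤
        ENNReal.ofReal N * weightedNorm m α (t + s) f := by
  have := finite_sum_le (d := d) m
  have := finite_sum_eq (d := d) m
  choose C hC hCb using fun γ : {γ : Fin d → ℕ // (∑ i, γ i) ≤ m} =>
    exists_holderBound_mder_weight m hα₀ hα₁ s t γ.2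
  choose C' hC' hCb' using fun γ : {γ : Fin d → ℕ // (∑ i, γ i) = m} =>
    exists_holderBound_mder_weight m hα₀ hα₁ s t γ.2.le
  have hS : 0 ≤ ∑' γ, C γ := tsum_nonneg hC
  have hS' : 0 ≤ ∑' γ, C' γ := tsum_nonneg hC'
  refine ⟨1 + (∑' γ, C γ + ∑' γ, C' γ), by positivity, fun f hf => ?_⟩
  by_cases htop : weightedNorm m α (t + s) f = ⊤
  · rw [htop, ENNReal.mul_top (by simp; positivity)]
    exact le_top
  have hW := weightedBound_of_weightedNorm_ne_top htop
  have hmul : ∀ {c : ℝ}, 0 ≤ c →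
      ENNReal.ofReal (c * (weightedNorm m α (t + s) f).toReal) =
        ENNReal.ofReal c * weightedNorm m α (t + s) f := fun hc => by
    rw [ENNReal.ofReal_mul hc, ENNReal.ofReal_toReal htop]
  calc weightedNorm m α t (fun x => r1 x ^ s * f x)
      ≤ ENNReal.ofReal (∑' γ, C γ) * weightedNorm m α (t + s) f +
        ENNReal.ofReal (∑' γ, C' γ) * weightedNorm m α (t + s) f :=
        add_le_add
          (tsum_le_ofReal_tsum_mul hC fun γ => (hmul (hC γ)) ▸ (hCb γ f _ hf hW).nrm0_le)
          (tsum_le_ofReal_tsum_mul hC' fun γ => (hmul (hC' γ)) ▸ (hCb' γ f _ hf hW).hsemi_le)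
    _ ≤ ENNReal.ofReal (1 + (∑' γ, C γ + ∑' γ, C' γ)) * weightedNorm m α (t + s) f := by
        rw [← add_mul, ← ENNReal.ofReal_add hS hS']
        exact mul_le_mul_left (ENNReal.ofReal_le_ofReal (by linarith)) _

lemma holNorm_eq_weightedNorm (β : ℝ) (f : Euc d → ℝ) :
    holNorm β f = weightedNorm (ifl β) (frc β) 0 f := by
  simp [holNorm, weightedNorm]

lemma tsum_sum_eq_le_tsum_sum_le (m : ℕ) (F : (Fin d → ℕ) → ℝ≥0∞) :
    ∑' γ : {γ : Fin d → ℕ // (∑ i, γ i) = m}, F γ.1 ≤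
      ∑' γ : {γ : Fin d → ℕ // (∑ i, γ i) ≤ m}, F γ.1 :=
  ENNReal.tsum_mono_subtype F
    (s := {γ | (∑ i, γ i) = m}) (t := {γ | (∑ i, γ i) ≤ m}) fun _ hγ => le_of_eq hγ

lemma frc_mem {β : ℝ} (hβ : 0 < β) : 0 ≤ frc β ∧ frc β ≤ 1 := by
  have hpos : 1 ≤ ⌈β⌉₊ := Nat.ceil_pos.2 hβ
  have h₁ := Nat.le_ceil β
  have h₂ := Nat.ceil_lt_add_one hβ.le
  unfold frc ifl
  push_cast [hpos]
  constructor <;> linarith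

end WeightedNorms

/-- equivalence of weighted Hölder norms, full sum version. -/
theorem stmt_5 (d : ℕ) (hd : 1 ≤ d) (θ β : ℝ) (hθ : 0 ≤ θ) (hβ : 1 < β) :
    ∃ N₁ N₂ : ℝ, 0 < N₁ ∧ 0 < N₂ ∧
      ∀ φ : Euc d → ℝ, ContDiff ℝ (ifl β : ℕ) φ →
        (ENNReal.ofReal N₁ * holNorm β (fun x => r1 x ^ (-θ) * φ x) ≤
            (∑' γ : {γ : Fin d → ℕ // (∑ i, γ i) ≤ ifl β},
                nrm0 (fun x => r1 x ^ (-θ) * mder γ.1 φ x))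
              + ∑' γ : {γ : Fin d → ℕ // (∑ i, γ i) = ifl β},
                  (nrm0 (fun x => r1 x ^ (-θ) * mder γ.1 φ x)
                    + hsemi (frc β) (fun x => r1 x ^ (-θ) * mder γ.1 φ x)))
        ∧ ((∑' γ : {γ : Fin d → ℕ // (∑ i, γ i) ≤ ifl β},
                nrm0 (fun x => r1 x ^ (-θ) * mder γ.1 φ x))
              + ∑' γ : {γ : Fin d → ℕ // (∑ i, γ i) = ifl β},
                  (nrm0 (fun x => r1 x ^ (-θ) * mder γ.1 φ x)
                    + hsemi (frc β) (fun x => r1 x ^ (-θ) * mder γ.1 φ x))) ≤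
            ENNReal.ofReal N₂ * holNorm β (fun x => r1 x ^ (-θ) * φ x) := by
  obtain ⟨hα₀, hα₁⟩ := frc_mem (zero_lt_one.trans hβ)
  obtain ⟨N, hN, hle⟩ := exists_weightedNorm_le d (ifl β) hα₀ hα₁ (-θ) 0
  obtain ⟨N', hN', hle'⟩ := exists_weightedNorm_le d (ifl β) hα₀ hα₁ θ (-θ)
  refine ⟨N⁻¹, 2 * N', inv_pos.2 hN, by positivity, fun φ hφ => ?_⟩
  rw [ENNReal.tsum_add, holNorm_eq_weightedNorm]
  constructor
  · calc ENNReal.ofReal N⁻¹ *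
          weightedNorm (ifl β) (frc β) 0 (fun x => r1 x ^ (-θ) * φ x)
        ≤ ENNReal.ofReal N⁻¹ * (ENNReal.ofReal N * weightedNorm (ifl β) (frc β) (-θ) φ) := by
          gcongr
          simpa using hle φ hφ
      _ = weightedNorm (ifl β) (frc β) (-θ) φ := by
          rw [← mul_assoc, ← ENNReal.ofReal_mul (inv_pos.2 hN).le, inv_mul_cancel₀ hN.ne',
            ENNReal.ofReal_one, one_mul]
      _ ≤ _ := add_le_add le_rfl le_add_self
  · have hback : (fun x => r1 x ^ θ * (r1 x ^ (-θ) * φ x)) = φ := by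
      funext x
      rw [← mul_assoc, ← Real.rpow_add (r1_pos x), add_neg_cancel, Real.rpow_zero, one_mul]
    have hφ' := hle' _ ((contDiff_r1_rpow (-θ)).mul hφ)
    rw [hback, neg_add_cancel] at hφ'
    calc _ ≤ weightedNorm (ifl β) (frc β) (-θ) φ + weightedNorm (ifl β) (frc β) (-θ) φ := by
          rw [add_left_comm, ← add_assoc, add_assoc]
          exact add_le_add ((tsum_sum_eq_le_tsum_sum_le (ifl β)
            fun γ => nrm0 (fun x => r1 x ^ (-θ) * mder γ φ x)).trans le_self_add) le_rfl
      _ ≤ _ := by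
          rw [← two_mul, ENNReal.ofReal_mul zero_le_two, ENNReal.ofReal_ofNat, mul_assoc]
          gcongr
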